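/- For 0 < q < 1 and every positive integer n, ∑_{k=0}^∞ q^{k(k+1)/2} A_q(q^{k-2n})/(q;q)_k = (-1)^n q^{-n²} (q;q²)_n, where A_q(z) = ∑_{m=0}^∞ q^{m²}(-z)^m/(q;q)_m. -/

import Mathlib

noncomputable def qp (q a : ℝ) (n : ℕ) : ℝ := ∏ k ∈ Finset.range n, (1 - a * q ^ k)

noncomputable def AqR (q z : ℝ) : ℝ := ∑' k : ℕ, q ^ (k ^ 2) * (-z) ^ k / qp q q k

open Filter Topology

lemma qp_succ (q a : ℝ) (n : ℕ) : qp q a (n+1) = qp q a n * (1 - a * q ^ n) := by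
  simp [qp, Finset.prod_range_succ]

lemma qp_pos {q : ℝ} (hq0 : 0 < q) (hq1 : q < 1) (n : ℕ) : 0 < qp q q n := by
  unfold qp
  apply Finset.prod_pos
  intro k _
  have : q ^ (k+1) < 1 := pow_lt_one₀ hq0.le hq1 (by omega)
  rw [pow_succ] at this
  linarith

noncomputable def et (q x : ℝ) (k : ℕ) : ℝ := q ^ (k.choose 2) * x ^ k / qp q q k

noncomputable def E (q x : ℝ) : ℝ := ∑' k, et q x k

lemma et_succ {q : ℝ} (hq0 : 0 < q) (hq1 : q < 1) (x : ℝ) (k : ℕ) :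
    et q x (k+1) = et q x k * (q ^ k * x / (1 - q * q ^ k)) := by
  have h1 := (qp_pos hq0 hq1 k).ne'
  have h2 := (qp_pos hq0 hq1 (k+1)).ne'
  rw [qp_succ] at h2
  have h3 := right_ne_zero_of_mul h2
  unfold et
  rw [qp_succ, Nat.choose_succ_succ' k 1, Nat.choose_one_right]
  field_simp
  ring

lemma et_summable {q : ℝ} (hq0 : 0 < q) (hq1 : q < 1) {x : ℝ} (hx : x ≠ 0) :
    Summable (et q x) := by
  have h0 : Tendsto (fun k : ℕ => q ^ k) atTop (𝓝 0) := tendsto_pow_atTop_nhds_zero_of_lt_one hq0.le hq1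
  have hne : ∀ k, et q x k ≠ 0 := fun k => by
    have := (qp_pos hq0 hq1 k).ne'
    unfold et; positivity
  refine summable_of_ratio_test_tendsto_lt_one (l := 0) one_pos (Eventually.of_forall hne) ?_
  have h1 : Tendsto (fun k : ℕ => ‖q ^ k * x / (1 - q * q ^ k)‖) atTop (𝓝 ‖0 * x / (1 - q * 0)‖) := by
    apply Tendsto.norm
    apply Tendsto.div (h0.mul_const _) (tendsto_const_nhds.sub (h0.const_mul _))
    simp
  simp only [zero_mul, zero_div, norm_zero] at h1
  refine h1.congr fun k => ?_
  rw [et_succ hq0 hq1, norm_mul, mul_div_cancel_left₀ _ (norm_ne_zero_iff.2 (hne k))]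

lemma E_feq {q : ℝ} (hq0 : 0 < q) (hq1 : q < 1) {x : ℝ} (hx : x ≠ 0) :
    E q x = (1 + x) * E q (q * x) := by
  have s1 := et_summable hq0 hq1 hx
  have s2 := et_summable hq0 hq1 (mul_ne_zero hq0.ne' hx)
  have h : ∑' k, (et q x k - et q (q*x) k) = x * E q (q * x) := by
    rw [(s1.sub s2).tsum_eq_zero_add, E, ← tsum_mul_left]
    have : et q x 0 - et q (q*x) 0 = 0 := by simp [et]
    rw [this, zero_add]
    congr 1; ext k
    have h1 := (qp_pos hq0 hq1 k).ne'
    have h2 := (qp_pos hq0 hq1 (k+1)).ne'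
    rw [qp_succ] at h2
    have h3 := right_ne_zero_of_mul h2
    unfold et
    rw [qp_succ, Nat.choose_succ_succ' k 1, Nat.choose_one_right]
    field_simp
    ring
  rw [s1.tsum_sub s2] at h
  change E q x - E q (q*x) = _ at h
  linarith

lemma E_iter {q : ℝ} (hq0 : 0 < q) (hq1 : q < 1) {x : ℝ} (hx : x ≠ 0) (N : ℕ) :
    E q x = qp q (-x) N * E q (q ^ N * x) := by
  induction N with
  | zero => simp [qp]
  | succ n ih =>
    rw [ih, E_feq hq0 hq1 (x := q^n*x) (by positivity), qp_succ, pow_succ']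
    ring_nf

lemma E_lim1 {q : ℝ} (hq0 : 0 < q) (hq1 : q < 1) {x : ℝ} (hx : x ≠ 0) :
    Tendsto (fun N : ℕ => E q (q ^ N * x)) atTop (𝓝 1) := by
  have h0 : Tendsto (fun k : ℕ => q ^ k) atTop (𝓝 0) := tendsto_pow_atTop_nhds_zero_of_lt_one hq0.le hq1
  have h1 : Tendsto (fun N : ℕ => E q (q ^ N * x)) atTop (𝓝 (∑' k, et q 0 k)) := by
    unfold E
    refine tendsto_tsum_of_dominated_convergence (bound := fun k => ‖et q x k‖) (et_summable hq0 hq1 hx).norm ?_ ?_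
    · intro k
      unfold et
      have : Tendsto (fun N : ℕ => q ^ N * x) atTop (𝓝 0) := by simpa using h0.mul_const x
      exact ((this.pow k).const_mul _).div_const _
    · refine Eventually.of_forall fun N k => ?_
      have : et q (q^N*x) k = (q^N)^k * et q x k := by unfold et; ring
      rw [this, norm_mul]
      refine mul_le_of_le_one_left (norm_nonneg _) ?_
      rw [Real.norm_of_nonneg (by positivity)]
      exact pow_le_one₀ (by positivity) (pow_le_one₀ hq0.le hq1.le)
  have h2 : ∑' k, et q 0 k = 1 := by
    rw [tsum_eq_single 0]
    · simp [et, qp]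
    · intro k hk; simp [et, hk]
  rwa [h2] at h1

lemma E_lim {q : ℝ} (hq0 : 0 < q) (hq1 : q < 1) {x : ℝ} (hx : x ≠ 0) :
    Tendsto (fun N => qp q (-x) N) atTop (𝓝 (E q x)) := by
  have h1 := E_lim1 hq0 hq1 hx
  have h3 := (tendsto_const_nhds (x := E q x)).div h1 one_ne_zero
  rw [div_one] at h3
  refine h3.congr' ?_
  filter_upwards [h1.eventually_ne one_ne_zero] with N hN
  simp only [Pi.div_apply]
  rw [E_iter hq0 hq1 hx N, mul_div_cancel_right₀ _ hN]

lemma E_ne {q : ℝ} (hq0 : 0 < q) (hq1 : q < 1) : E q (-q) ≠ 0 := by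
  have hx : -q ≠ 0 := neg_ne_zero.2 hq0.ne'
  obtain ⟨N, hN⟩ := ((E_lim1 hq0 hq1 hx).eventually_ne one_ne_zero).exists
  rw [E_iter hq0 hq1 hx N, neg_neg]
  exact mul_ne_zero (qp_pos hq0 hq1 N).ne' hN

lemma qp_fin (q : ℝ) (N : ℕ) :
    qp q (-q) N * qp (q ^ 2) q N * qp q q N = qp q q (2 * N) := by
  induction N with
  | zero => simp [qp]
  | succ n ih =>
    rw [show 2 * (n + 1) = 2 * n + 1 + 1 by ring]
    simp only [qp_succ]
    rw [← ih]
    ring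

lemma qp_sq (q : ℝ) (N : ℕ) : qp q (-q) N * qp q q N = qp (q ^ 2) (q ^ 2) N := by
  induction N with
  | zero => simp [qp]
  | succ n ih =>
    simp only [qp_succ]
    rw [← ih]
    ring

lemma E_key {q : ℝ} (hq0 : 0 < q) (hq1 : q < 1) : E q q * E (q ^ 2) (-q) = 1 := by
  have hx : -q ≠ 0 := neg_ne_zero.2 hq0.ne'
  have hs1 : q ^ 2 < 1 := pow_lt_one₀ hq0.le hq1 (by norm_num)
  have l1 := E_lim hq0 hq1 hq0.ne'
  have l2 := E_lim (q := q ^ 2) (by positivity) hs1 hx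
  have l3 := E_lim hq0 hq1 hx
  rw [neg_neg] at l2 l3
  have l4 := l3.comp (tendsto_id.const_mul_atTop' (show 0 < 2 by norm_num))
  have l5 := (l1.mul l2).mul l3
  have h := tendsto_nhds_unique l5 (l4.congr fun N => (qp_fin q N).symm)
  exact mul_right_cancel₀ (E_ne hq0 hq1) (by rw [h, one_mul])

lemma qp_succ' (q a : ℝ) (n : ℕ) : qp q a (n+1) = (1 - a) * qp q (a * q) n := by
  simp only [qp, Finset.prod_range_succ', pow_zero, mul_one]
  rw [mul_comm]
  congr 1
  apply Finset.prod_congr rfl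
  intro k _
  ring

lemma qp_refl {q : ℝ} (hq0 : 0 < q) (n : ℕ) :
    qp (q ^ 2) (q * (q ^ (2 * n))⁻¹) n = (-1) ^ n * (q ^ (n ^ 2))⁻¹ * qp (q ^ 2) q n := by
  induction n with
  | zero => simp [qp]
  | succ n ih =>
    rw [qp_succ', show q * (q ^ (2 * (n+1)))⁻¹ * q ^ 2 = q * (q ^ (2 * n))⁻¹ by field_simp; ring,
      ih, qp_succ]
    field_simp
    ring

lemma choose_tri (k : ℕ) : k * (k + 1) / 2 = k.choose 2 + k := by
  have h := Nat.choose_two_right (k+1)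
  rw [Nat.choose_succ_succ' k 1, Nat.choose_one_right, Nat.add_sub_cancel, mul_comm] at h
  rw [← h]
  exact add_comm _ _

lemma sq_choose (k : ℕ) : k ^ 2 = 2 * k.choose 2 + k := by
  induction k with
  | zero => simp
  | succ n ih =>
    rw [Nat.choose_succ_succ' n 1, Nat.choose_one_right]
    nlinarith

theorem Aq_sum_even_eval (q : ℝ) (hq0 : 0 < q) (hq1 : q < 1) (n : ℕ) (hn : 0 < n) :
    ∑' k : ℕ, q ^ (k * (k + 1) / 2) * AqR q (q ^ ((k : ℤ) - 2 * n)) / qp q q k =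
      (-1) ^ n * (q ^ (n ^ 2))⁻¹ * qp (q ^ 2) q n := by
  have hs1 : q ^ 2 < 1 := pow_lt_one₀ hq0.le hq1 (by norm_num)
  set y : ℝ := (q ^ (2 * n))⁻¹ with hy
  have hy0 : 0 < y := by positivity
  let F : ℕ → ℕ → ℝ := fun k m => et q q k * q ^ (k * m) * (q ^ (m ^ 2) * (-y) ^ m / qp q q m)
  have hz : ∀ k : ℕ, q ^ ((k : ℤ) - 2 * n) = q ^ k * y := by
    intro k
    rw [zpow_sub₀ hq0.ne', zpow_natCast, div_eq_mul_inv, hy]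
    norm_cast
  have hL : ∀ k : ℕ, q ^ (k * (k + 1) / 2) * AqR q (q ^ ((k : ℤ) - 2 * n)) / qp q q k
      = ∑' m, F k m := by
    intro k
    rw [hz, AqR, mul_div_right_comm, ← tsum_mul_left]
    congr 1; ext m
    simp only [F, et, choose_tri]
    rw [neg_pow (q ^ k * y), neg_pow y]
    ring
  have hF : Summable (Function.uncurry F) := by
    have hA := (et_summable hq0 hq1 hq0.ne').norm
    have hB := (et_summable hq0 hq1 hy0.ne').norm
    refine Summable.of_norm_bounded (hA.mul_of_nonneg hB (fun _ => norm_nonneg _) fun _ => norm_nonneg _) ?_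
    rintro ⟨k, m⟩
    have h1 : Function.uncurry F (k, m) =
        (q ^ (k * m) * q ^ (m.choose 2 + m) * (-1) ^ m) * (et q q k * et q y m) := by
      simp only [Function.uncurry, F, et]
      rw [neg_pow y, sq_choose m]
      ring
    rw [h1, norm_mul]
    dsimp only
    rw [← norm_mul (et q q k)]
    refine mul_le_of_le_one_left (norm_nonneg _) ?_
    rw [norm_mul, norm_pow (-1 : ℝ), norm_neg, norm_one, one_pow, mul_one,
      Real.norm_of_nonneg (by positivity)]
    exact mul_le_one₀ (pow_le_one₀ hq0.le hq1.le) (by positivity) (pow_le_one₀ hq0.le hq1.le)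
  have hin : ∀ m, ∑' k, F k m = E q q * et (q ^ 2) (-(q * y)) m := by
    intro m
    have h1 : ∑' k, F k m = E q (q ^ m * q) * (q ^ (m ^ 2) * (-y) ^ m / qp q q m) := by
      rw [E, ← tsum_mul_right]
      congr 1; ext k
      simp only [F, et]
      ring
    have hp : 0 < qp (q ^ 2) (q ^ 2) m := qp_pos (by positivity) hs1 m
    have h2 := qp_sq q m
    rw [h1, E_iter hq0 hq1 hq0.ne' m, et, ← h2, sq_choose m, neg_pow y, neg_pow (q * y)]
    rw [← h2] at hp
    have h3 := left_ne_zero_of_mul hp.ne'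
    have h4 := right_ne_zero_of_mul hp.ne'
    field_simp
    ring
  rw [tsum_congr hL, ← hF.tsum_comm, tsum_congr hin, tsum_mul_left]
  change E q q * E (q ^ 2) (-(q * y)) = _
  rw [E_iter (q := q ^ 2) (by positivity) hs1 (neg_ne_zero.2 (by positivity)) n, neg_neg,
    hy, qp_refl hq0,
    show (q ^ 2) ^ n * -(q * (q ^ (2 * n))⁻¹) = -q by rw [← pow_mul]; field_simp]
  linear_combination ((-1) ^ n * (q ^ (n ^ 2))⁻¹ * qp (q ^ 2) q n) * E_key hq0 hq1
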